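/- For all integers i ≥ 1 and j ≥ 1 and all elements f, g ∈ F, the commutator [∂^i + f, ∫^j + g] = (∂^i + f)(∫^j + g) − (∫^j + g)(∂^i + f) is nonzero. -/

import Mathlib

open Polynomial

noncomputable section
set_option synthInstance.maxHeartbeats 1000000
set_option maxHeartbeats 1000000
set_option linter.unusedSectionVars false

variable (K : Type*) [Field K] [CharZero K]

/-- The derivative operator `∂ = d/dx` on `K[x]`. -/
def derOp : Module.End K (Polynomial K) := Polynomial.derivative

/-- The multiplication-by-`x` operator on `K[x]`. -/
def xOp : Module.End K (Polynomial K) := LinearMap.mulLeft K Polynomial.X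

/-- The integration operator `∫`, determined by `∫ xⁿ = xⁿ⁺¹/(n+1)`. -/
def intOp : Module.End K (Polynomial K) :=
  (Polynomial.basisMonomials K).constr K fun n => ((n : K) + 1)⁻¹ • X ^ (n + 1)

/-- The algebra `I₁` of polynomial integro-differential operators: the subalgebra of
`End_K(K[x])` generated by `x`, `∂` and `∫`. -/
def I1 : Subalgebra K (Module.End K (Polynomial K)) :=
  Algebra.adjoin K {xOp K, derOp K, intOp K}

/-- `e_{ij} := ∫^i ∂^j − ∫^{i+1} ∂^{j+1}`. -/
def eOp (i j : ℕ) : Module.End K (Polynomial K) :=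
  intOp K ^ i * derOp K ^ j - intOp K ^ (i + 1) * derOp K ^ (j + 1)

/-- `F`, the `K`-linear span of the `e_{ij}`; it is the (two-sided) ideal of compact
operators of `I₁`. -/
def Fset : Submodule K (Module.End K (Polynomial K)) :=
  Submodule.span K {f | ∃ i j, f = eOp K i j}

lemma xOp_mem : xOp K ∈ I1 K := Algebra.subset_adjoin (by simp)
lemma derOp_mem : derOp K ∈ I1 K := Algebra.subset_adjoin (by simp)
lemma intOp_mem : intOp K ∈ I1 K := Algebra.subset_adjoin (by simp)

lemma eOp_mem (i j : ℕ) : eOp K i j ∈ I1 K :=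
  sub_mem (mul_mem (pow_mem (intOp_mem K) i) (pow_mem (derOp_mem K) j))
    (mul_mem (pow_mem (intOp_mem K) (i + 1)) (pow_mem (derOp_mem K) (j + 1)))

/-- `e_{ij}` as an element of the ring `I₁`. -/
def eI (i j : ℕ) : I1 K := ⟨eOp K i j, eOp_mem K i j⟩

/-- `∂` as an element of the ring `I₁`. -/
def derI : I1 K := ⟨derOp K, derOp_mem K⟩

/-- `∫` as an element of the ring `I₁`. -/
def intI : I1 K := ⟨intOp K, intOp_mem K⟩

/-- `H := ∂ ∘ x` (first multiply by `x`, then differentiate). -/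
def hOp : Module.End K (Polynomial K) := derOp K * xOp K

/-- `K[H]`, the unital subalgebra of `I₁` generated by `H`. -/
def KH : Subalgebra K (Module.End K (Polynomial K)) := Algebra.adjoin K {hOp K}

/-- The action of `a ∈ I₁` on a left `I₁`-module `M`, as a `K`-linear map `a_M : M → M`. -/
def actMap (a : I1 K) (M : Type*) [AddCommGroup M] [Module (I1 K) M] [Module K M]
    [SMulCommClass K (I1 K) M] : M →ₗ[K] M where
  toFun m := a • m
  map_add' := smul_add a
  map_smul' k m := (smul_comm k a m).symm

/-- Right multiplication `b ↦ b * a` in a ring `R`, as a homomorphism of left `R`-modules. -/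
def rmulMap (R : Type*) [Ring R] (a : R) : R →ₗ[R] R where
  toFun b := b * a
  map_add' b c := add_mul b c a
  map_smul' c b := by simp [smul_eq_mul, mul_assoc]

/-- Left multiplication `b ↦ a * b` in a ring `R`, as a homomorphism of right `R`-modules
(i.e. of left `Rᵐᵒᵖ`-modules). -/
def lmulMap (R : Type*) [Ring R] (a : R) : R →ₗ[Rᵐᵒᵖ] R where
  toFun b := a * b
  map_add' b c := mul_add a b c
  map_smul' c b := by simp [MulOpposite.smul_eq_mul_unop, mul_assoc]

/-- The centralizer `Cen_{I₁}(a) = {b ∈ I₁ : ab = ba}` of `a` in `I₁`, as a subalgebra of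
`End_K(K[x])`. -/
def Cen (a : Module.End K (Polynomial K)) : Subalgebra K (Module.End K (Polynomial K)) :=
  I1 K ⊓ Subalgebra.centralizer K {a}

/-- `Cen_F(a) = {f ∈ F : af = fa}`, a `K`-subspace of `End_K(K[x])`. -/
def CenF (a : Module.End K (Polynomial K)) : Submodule K (Module.End K (Polynomial K)) :=
  Fset K ⊓ Subalgebra.toSubmodule (Subalgebra.centralizer K {a})


/-- The partial sums of the diagonal entries of `T` in the monomial basis are eventually `t`. -/
def HasDiagSum {R : Type*} [CommRing R] (T : Module.End R R[X]) (t : R) : Prop :=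
  ∀ᶠ N in Filter.atTop, ∑ n ∈ Finset.range N, (T (X ^ n)).coeff n = t

namespace HasDiagSum

variable {R : Type*} [CommRing R] {S T : Module.End R R[X]} {s t : R}

lemma zero : HasDiagSum (0 : Module.End R R[X]) 0 :=
  Filter.Eventually.of_forall fun N => by simp

lemma unique (hs : HasDiagSum T s) (ht : HasDiagSum T t) : s = t := by
  obtain ⟨N, h₁, h₂⟩ := (Filter.Eventually.and hs ht).exists
  exact h₁.symm.trans h₂

lemma add (hS : HasDiagSum S s) (hT : HasDiagSum T t) : HasDiagSum (S + T) (s + t) := by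
  filter_upwards [hS, hT] with N h₁ h₂
  simp [Finset.sum_add_distrib, h₁, h₂]

lemma sub (hS : HasDiagSum S s) (hT : HasDiagSum T t) : HasDiagSum (S - T) (s - t) := by
  filter_upwards [hS, hT] with N h₁ h₂
  simp [Finset.sum_sub_distrib, h₁, h₂]

lemma smul (c : R) (hT : HasDiagSum T t) : HasDiagSum (c • T) (c * t) := by
  filter_upwards [hT] with N h
  simp [← Finset.mul_sum, h]

lemma smulRight (φ : R[X] →ₗ[R] R) (v : R[X]) : HasDiagSum (φ.smulRight v) (φ v) := by
  filter_upwards [Filter.eventually_gt_atTop v.natDegree] with N hN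
  conv_rhs => rw [v.as_sum_range' N hN, map_sum]
  refine Finset.sum_congr rfl fun n _ => ?_
  rw [← mul_one (v.coeff n), ← smul_eq_mul, ← smul_monomial, map_smul, monomial_one_right_eq_X_pow]
  simp [mul_comm]

end HasDiagSum

/-- The finite-rank endomorphisms of `M`, as the span of the rank-one ones. -/
def rankOneSpan (R M : Type*) [CommRing R] [AddCommGroup M] [Module R M] :
    Submodule R (Module.End R M) :=
  Submodule.span R {T | ∃ (φ : M →ₗ[R] R) (v : M), T = φ.smulRight v}

section rankOneSpan

variable {R M : Type*} [CommRing R] [AddCommGroup M] [Module R M] {T : Module.End R M}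

lemma smulRight_mem_rankOneSpan (φ : M →ₗ[R] R) (v : M) :
    (φ.smulRight v : Module.End R M) ∈ rankOneSpan R M :=
  Submodule.subset_span ⟨φ, v, rfl⟩

lemma smulRight_mul (φ : M →ₗ[R] R) (v : M) (S : Module.End R M) :
    (φ.smulRight v : Module.End R M) * S = (φ ∘ₗ S).smulRight v := by
  ext; simp

lemma mul_smulRight (φ : M →ₗ[R] R) (v : M) (S : Module.End R M) :
    S * (φ.smulRight v : Module.End R M) = φ.smulRight (S v) := by
  ext; simp

lemma mul_mem_rankOneSpan (hT : T ∈ rankOneSpan R M) (S : Module.End R M) :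
    T * S ∈ rankOneSpan R M := by
  induction hT using Submodule.span_induction with
  | mem T h =>
    obtain ⟨φ, v, rfl⟩ := h
    rw [smulRight_mul]
    exact smulRight_mem_rankOneSpan _ _
  | zero => simp
  | add T U _ _ hT hU => rw [add_mul]; exact add_mem hT hU
  | smul c T _ hT => rw [smul_mul_assoc]; exact Submodule.smul_mem _ c hT

lemma mul_mem_rankOneSpan_left (hT : T ∈ rankOneSpan R M) (S : Module.End R M) :
    S * T ∈ rankOneSpan R M := by
  induction hT using Submodule.span_induction with
  | mem T h =>
    obtain ⟨φ, v, rfl⟩ := h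
    rw [mul_smulRight]
    exact smulRight_mem_rankOneSpan _ _
  | zero => simp
  | add T U _ _ hT hU => rw [mul_add]; exact add_mem hT hU
  | smul c T _ hT => rw [mul_smul_comm]; exact Submodule.smul_mem _ c hT

lemma add_pow_sub_pow_mem_rankOneSpan (hT : T ∈ rankOneSpan R M) (S : Module.End R M) (n : ℕ) :
    (S + T) ^ n - S ^ n ∈ rankOneSpan R M := by
  induction n with
  | zero => simp
  | succ n ih =>
    have h : (S + T) ^ (n + 1) - S ^ (n + 1) = ((S + T) ^ n - S ^ n) * S + (S + T) ^ n * T := by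
      rw [pow_succ, pow_succ]; noncomm_ring
    rw [h]
    exact add_mem (mul_mem_rankOneSpan ih S) (mul_mem_rankOneSpan_left hT _)

/-- The trace of a commutator with a finite-rank operator vanishes. -/
lemma hasDiagSum_commutator {T : Module.End R R[X]} (hT : T ∈ rankOneSpan R R[X])
    (S : Module.End R R[X]) : HasDiagSum (T * S - S * T) 0 := by
  induction hT using Submodule.span_induction with
  | mem T h =>
    obtain ⟨φ, v, rfl⟩ := h
    rw [smulRight_mul, mul_smulRight]
    simpa using (HasDiagSum.smulRight (φ ∘ₗ S) v).sub (HasDiagSum.smulRight φ (S v))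
  | zero => simpa using HasDiagSum.zero
  | add T U _ _ hT hU =>
    have h : (T + U) * S - S * (T + U) = (T * S - S * T) + (U * S - S * U) := by noncomm_ring
    rw [h]
    simpa using hT.add hU
  | smul c T _ hT =>
    rw [smul_mul_assoc, mul_smul_comm, ← smul_sub]
    simpa using hT.smul c

end rankOneSpan

lemma intOp_X_pow (n : ℕ) : intOp K (X ^ n) = ((n : K) + 1)⁻¹ • X ^ (n + 1) := by
  have h : (X ^ n : K[X]) = basisMonomials K n := by
    simp only [coe_basisMonomials, monomial_one_right_eq_X_pow]
  rw [intOp, h, Module.Basis.constr_basis]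

lemma derOp_X_pow_succ (n : ℕ) : derOp K (X ^ (n + 1)) = ((n : K) + 1) • X ^ n := by
  simp [derOp, smul_eq_C_mul]

lemma derOp_mul_intOp : derOp K * intOp K = 1 := by
  refine (basisMonomials K).ext fun n => ?_
  have hn : (n : K) + 1 ≠ 0 := by exact_mod_cast n.succ_ne_zero
  simp only [coe_basisMonomials, monomial_one_right_eq_X_pow, Module.End.mul_apply, intOp_X_pow,
    map_smul, Module.End.one_apply, derOp_X_pow_succ, smul_smul, inv_mul_cancel₀ hn, one_smul]

lemma derOp_pow_mul_intOp_pow (n : ℕ) : derOp K ^ n * intOp K ^ n = 1 := by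
  induction n with
  | zero => simp
  | succ n ih =>
    rw [pow_succ, pow_succ', mul_assoc, ← mul_assoc (derOp K), derOp_mul_intOp, one_mul, ih]

lemma one_sub_intOp_mul_derOp :
    1 - intOp K * derOp K = (lcoeff K 0).smulRight (1 : K[X]) := by
  refine (basisMonomials K).ext fun n => ?_
  simp only [coe_basisMonomials, monomial_one_right_eq_X_pow]
  cases n with
  | zero => simp [derOp]
  | succ n =>
    have hn : (n : K) + 1 ≠ 0 := by exact_mod_cast n.succ_ne_zero
    simp [derOp_X_pow_succ, intOp_X_pow, smul_smul, hn]

lemma eOp_eq_smulRight (i j : ℕ) :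
    eOp K i j = (lcoeff K 0 ∘ₗ derOp K ^ j).smulRight ((intOp K ^ i) 1) := by
  have h : eOp K i j = intOp K ^ i * (1 - intOp K * derOp K) * derOp K ^ j := by
    simp only [eOp, pow_succ, pow_succ' (derOp K), mul_sub, sub_mul, mul_one, mul_assoc]
  rw [h, one_sub_intOp_mul_derOp, mul_smulRight, smulRight_mul]

lemma Fset_le_rankOneSpan : Fset K ≤ rankOneSpan K K[X] := by
  refine Submodule.span_mono ?_
  rintro _ ⟨i, j, rfl⟩
  exact ⟨_, _, eOp_eq_smulRight K i j⟩

lemma hasDiagSum_eOp_self (n : ℕ) : HasDiagSum (eOp K n n) 1 := by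
  have h : (lcoeff K 0 ∘ₗ derOp K ^ n) ((intOp K ^ n) 1) = 1 := by
    rw [LinearMap.comp_apply, ← Module.End.mul_apply, derOp_pow_mul_intOp_pow]
    simp
  rw [eOp_eq_smulRight]
  simpa only [h] using HasDiagSum.smulRight (lcoeff K 0 ∘ₗ derOp K ^ n) ((intOp K ^ n) 1)

lemma hasDiagSum_one_sub_intOp_pow_mul_derOp_pow (n : ℕ) :
    HasDiagSum (1 - intOp K ^ n * derOp K ^ n) (n : K) := by
  induction n with
  | zero => simpa using HasDiagSum.zero
  | succ n ih =>
    simpa [eOp] using ih.add (hasDiagSum_eOp_self K n)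

lemma hasDiagSum_commutator_pow {f g : Module.End K K[X]} (n : ℕ)
    (hf : f ∈ rankOneSpan K K[X]) (hg : g ∈ rankOneSpan K K[X]) :
    HasDiagSum ((derOp K ^ n + f) * (intOp K ^ n + g) - (intOp K ^ n + g) * (derOp K ^ n + f))
      (n : K) := by
  have h : (derOp K ^ n + f) * (intOp K ^ n + g) - (intOp K ^ n + g) * (derOp K ^ n + f) =
      (derOp K ^ n * intOp K ^ n - intOp K ^ n * derOp K ^ n) +
        (f * (intOp K ^ n + g) - (intOp K ^ n + g) * f) -
        (g * derOp K ^ n - derOp K ^ n * g) := by noncomm_ring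
  rw [h, derOp_pow_mul_intOp_pow]
  simpa using ((hasDiagSum_one_sub_intOp_pow_mul_derOp_pow K n).add
    (hasDiagSum_commutator hf _)).sub (hasDiagSum_commutator hg _)

/-- for all `i, j ≥ 1` and `f, g ∈ F`, the commutator
`[∂^i + f, ∫^j + g]` is nonzero. -/
theorem statement13 (i j : ℕ) (hi : 1 ≤ i) (hj : 1 ≤ j)
    (f g : Module.End K (Polynomial K)) (hf : f ∈ Fset K) (hg : g ∈ Fset K) :
    (derOp K ^ i + f) * (intOp K ^ j + g) - (intOp K ^ j + g) * (derOp K ^ i + f) ≠ 0 := by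
  intro h
  have hf' := add_pow_sub_pow_mem_rankOneSpan (Fset_le_rankOneSpan K hf) (derOp K ^ i) j
  have hg' := add_pow_sub_pow_mem_rankOneSpan (Fset_le_rankOneSpan K hg) (intOp K ^ j) i
  have hcomm : Commute ((derOp K ^ i + f) ^ j) ((intOp K ^ j + g) ^ i) :=
    Commute.pow_pow (sub_eq_zero.mp h) j i
  have ht := hasDiagSum_commutator_pow K (i * j) hf' hg'
  rw [← pow_mul, ← pow_mul, mul_comm j i, add_sub_cancel, add_sub_cancel, hcomm.eq, sub_self] at ht
  have h0 : ((i * j : ℕ) : K) = 0 := ht.unique HasDiagSum.zero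
  rw [Nat.cast_eq_zero, mul_eq_zero] at h0
  omega

end
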